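/- arXiv:1902.08986 — 6 statements merged into one kernel-verified Lean document; each statement's English description precedes it below -/
import Mathlib

section
/- Let G be a connected simple graph on a nonempty finite vertex set V and let ρ : V → ℝ satisfy ∑_{i∈V} ρ_i > 0. Then there exists a real number b such that the matrix diag(ρ) + b·L(G) is positive definite, where L(G) is the graph Laplacian of G. -/
open Matrix in
/-- **Finsler's lemma**: a real symmetric matrix that is positive on the nonzero kernel vectors of a
positive semidefinite matrix `P` becomes positive definite after adding a multiple of `P`. -/
theorem Matrix.IsHermitian.exists_posDef_add_smul {n : Type*} [Fintype n] {M P : Matrix n n ℝ}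
    (hM : M.IsHermitian) (hP : P.PosSemidef)
    (h : ∀ x, x ≠ 0 → P *ᵥ x = 0 → 0 < x ⬝ᵥ (M *ᵥ x)) :
    ∃ b : ℝ, (M + b • P).PosDef := by
  have hf : Continuous fun x : n → ℝ ↦ x ⬝ᵥ (M *ᵥ x) := by fun_prop
  have hg : Continuous fun x : n → ℝ ↦ x ⬝ᵥ (P *ᵥ x) := by fun_prop
  have hg_nonneg (x : n → ℝ) : 0 ≤ x ⬝ᵥ (P *ᵥ x) := by
    simpa using hP.dotProduct_mulVec_nonneg x
  have hg_pos (x : n → ℝ) (hx : x ≠ 0) (hfx : x ⬝ᵥ (M *ᵥ x) ≤ 0) : 0 < x ⬝ᵥ (P *ᵥ x) := by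
    refine (hg_nonneg x).lt_of_ne' fun h0 ↦ hfx.not_gt (h x hx ?_)
    exact (hP.dotProduct_mulVec_zero_iff x).1 (by simpa using h0)
  have hK : IsCompact (Metric.sphere (0 : n → ℝ) 1 ∩ {x | x ⬝ᵥ (M *ᵥ x) ≤ 0}) :=
    (isCompact_sphere 0 1).inter_right (isClosed_le hf continuous_const)
  obtain ⟨C, hC⟩ := hK.exists_bound_of_continuousOn
    (f := fun x ↦ (x ⬝ᵥ (M *ᵥ x)) / (x ⬝ᵥ (P *ᵥ x)))
    (hf.continuousOn.div hg.continuousOn fun x hx ↦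
      (hg_pos x (ne_zero_of_mem_unit_sphere ⟨x, hx.1⟩) hx.2).ne')
  have hsphere (x : n → ℝ) (hx : ‖x‖ = 1) :
      0 < x ⬝ᵥ (M *ᵥ x) + (|C| + 1) * (x ⬝ᵥ (P *ᵥ x)) := by
    rcases lt_or_ge 0 (x ⬝ᵥ (M *ᵥ x)) with hfx | hfx
    · have := hg_nonneg x
      positivity
    · have hgx := hg_pos x (norm_ne_zero_iff.1 (by simp [hx])) hfx
      have hle := (abs_le.1 ((hC x ⟨by simpa using hx, hfx⟩).trans (le_abs_self C))).1
      rw [le_div_iff₀ hgx] at hle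
      linarith
  refine ⟨|C| + 1, .of_dotProduct_mulVec_pos
    (hM.add (hP.isHermitian.smul (IsSelfAdjoint.all _))) fun x hx ↦ ?_⟩
  have hx' : 0 < ‖x‖ := norm_pos_iff.2 hx
  have := hsphere (‖x‖⁻¹ • x) (by simp [norm_smul, hx'.ne'])
  simp only [mulVec_smul, smul_dotProduct, dotProduct_smul, smul_eq_mul] at this
  simp only [star_trivial, add_mulVec, smul_mulVec, dotProduct_add, dotProduct_smul, smul_eq_mul]
  refine pos_of_mul_pos_right (a := ‖x‖⁻¹ * ‖x‖⁻¹) ?_ (by positivity)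
  linarith


/-- For a connected simple graph `G` on a nonempty finite vertex set `V` and
`ρ : V → ℝ` with `∑ i, ρ i > 0`, there is a real `b` such that `diag(ρ) + b • L(G)` is
positive definite. -/
theorem exists_gain_posDef_of_sum_pos
    {V : Type*} [Fintype V] [DecidableEq V] [Nonempty V]
    (G : SimpleGraph V) [DecidableRel G.Adj] (hG : G.Connected)
    (ρ : V → ℝ) (hρ : 0 < ∑ i, ρ i) :
    ∃ b : ℝ, (Matrix.diagonal ρ + b • G.lapMatrix ℝ).PosDef := by
  refine (Matrix.isHermitian_diagonal ρ).exists_posDef_add_smul (G.posSemidef_lapMatrix ℝ)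
    fun x hx hLx ↦ ?_
  rw [G.lapMatrix_mulVec_eq_zero_iff_forall_reachable] at hLx
  obtain ⟨i, hi⟩ := Function.ne_iff.1 hx
  have hconst : x = fun _ ↦ x i := funext fun j ↦ hLx j i (hG.preconnected j i)
  have hform : dotProduct x ((Matrix.diagonal ρ).mulVec x) = (∑ j, ρ j) * (x i * x i) := by
    rw [hconst, Finset.sum_mul]
    simp only [dotProduct, Matrix.mulVec_diagonal]
    exact Finset.sum_congr rfl fun j _ ↦ by ring
  rw [hform]
  exact mul_pos hρ (mul_self_pos.2 hi)
end

section
/- Let G be a connected simple graph on a nonempty finite vertex set V and let ρ : V → ℝ. There exists a real number b such that diag(ρ) + b·L(G) is positive definite if and only if ∑_{i∈V} ρ_i > 0, where L(G) is the graph Laplacian of G. -/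
/-- Two continuous functions on a compact set, the second nonnegative, the first positive wherever
the second vanishes: some combination `p + b * q` is positive on the whole set. -/
theorem IsCompact.exists_forall_add_mul_pos {X : Type*} [TopologicalSpace X] {S : Set X}
    (hS : IsCompact S) {p q : X → ℝ} (hp : Continuous p) (hq : Continuous q)
    (hq_nonneg : ∀ x, 0 ≤ q x) (hpq : ∀ x ∈ S, q x = 0 → 0 < p x) :
    ∃ b : ℝ, ∀ x ∈ S, 0 < p x + b * q x := by
  have hq_pos : ∀ x ∈ S ∩ {x | p x ≤ 0}, 0 < q x := fun x hx ↦
    (hq_nonneg x).lt_of_ne' fun h ↦ (hpq x hx.1 h).not_ge hx.2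
  have hcont : ContinuousOn (fun x ↦ -p x / q x) (S ∩ {x | p x ≤ 0}) :=
    hp.neg.continuousOn.div hq.continuousOn fun x hx ↦ (hq_pos x hx).ne'
  obtain ⟨B, hB⟩ :=
    (hS.inter_right (isClosed_le hp continuous_const)).bddAbove_image hcont
  refine ⟨max B 0 + 1, fun x hx ↦ ?_⟩
  have hb : 0 ≤ max B 0 := le_max_right B 0
  rcases le_or_gt (p x) 0 with h | h
  · have hqx := hq_pos x ⟨hx, h⟩
    have hle : -p x ≤ max B 0 * q x :=
      (div_le_iff₀ hqx).1 ((hB (Set.mem_image_of_mem _ ⟨hx, h⟩)).trans (le_max_left B 0))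
    linarith
  · have := hq_nonneg x
    positivity

open Matrix in
/-- **Finsler's lemma** for a positive semidefinite second form. -/
theorem Matrix.PosSemidef.exists_add_smul_posDef {n : Type*} [Fintype n]
    {A B : Matrix n n ℝ} (hA : A.IsHermitian) (hB : B.PosSemidef)
    (hAB : ∀ x : n → ℝ, x ≠ 0 → x ⬝ᵥ (B *ᵥ x) = 0 → 0 < x ⬝ᵥ (A *ᵥ x)) :
    ∃ b : ℝ, (A + b • B).PosDef := by
  have hcont (M : Matrix n n ℝ) : Continuous fun x : n → ℝ ↦ x ⬝ᵥ (M *ᵥ x) :=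
    continuous_id.dotProduct (continuous_const.matrix_mulVec continuous_id)
  obtain ⟨b, hb⟩ := (isCompact_sphere (0 : n → ℝ) 1).exists_forall_add_mul_pos (hcont A) (hcont B)
    (fun x ↦ by simpa using hB.dotProduct_mulVec_nonneg x)
    (fun x hx ↦ hAB x (ne_zero_of_mem_unit_sphere ⟨x, hx⟩))
  refine ⟨b, .of_dotProduct_mulVec_pos (hA.add (hB.1.smul (.all b))) fun x hx ↦ ?_⟩
  have hnorm : 0 < ‖x‖ := norm_pos_iff.2 hx
  have hunit := hb (‖x‖⁻¹ • x) (by simp [norm_smul, hnorm.ne'])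
  simp only [mulVec_smul, smul_dotProduct, dotProduct_smul, smul_eq_mul] at hunit
  simp only [star_trivial, add_mulVec, smul_mulVec, dotProduct_add, dotProduct_smul, smul_eq_mul]
  refine pos_of_mul_pos_right (a := ‖x‖⁻¹ * ‖x‖⁻¹) ?_ (by positivity)
  linarith

/-- For a connected simple graph `G` on a nonempty finite vertex set `V` and
`ρ : V → ℝ`, there exists `b : ℝ` with `diag(ρ) + b • L(G)` positive definite if and only
if `∑ i, ρ i > 0`. -/
theorem exists_gain_posDef_iff_sum_pos
    {V : Type*} [Fintype V] [DecidableEq V] [Nonempty V]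
    (G : SimpleGraph V) [DecidableRel G.Adj] (hG : G.Connected)
    (ρ : V → ℝ) :
    (∃ b : ℝ, (Matrix.diagonal ρ + b • G.lapMatrix ℝ).PosDef) ↔ 0 < ∑ i, ρ i := by
  constructor
  · rintro ⟨b, hb⟩
    have hone := hb.dotProduct_mulVec_pos (x := fun _ ↦ 1) (Function.ne_iff.2 (by simp))
    rw [Matrix.add_mulVec, Matrix.smul_mulVec, G.lapMatrix_mulVec_const_eq_zero] at hone
    simpa [dotProduct, Matrix.mulVec_diagonal] using hone
  · intro hρ
    refine Matrix.PosSemidef.exists_add_smul_posDef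
      (Matrix.isHermitian_diagonal ρ) (G.posSemidef_lapMatrix ℝ) fun x hx h ↦ ?_
    rw [← Matrix.toLinearMap₂'_apply',
      G.lapMatrix_toLinearMap₂'_apply'_eq_zero_iff_forall_reachable] at h
    obtain ⟨v, hv⟩ := Function.ne_iff.1 hx
    have hconst (i : V) : x i = x v := h i v (hG.preconnected i v)
    have hform : dotProduct x ((Matrix.diagonal ρ).mulVec x) = x v ^ 2 * ∑ i, ρ i := by
      simp only [dotProduct, Matrix.mulVec_diagonal, hconst, Finset.mul_sum]
      exact Finset.sum_congr rfl fun i _ ↦ by ring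
    rw [hform]
    exact mul_pos (sq_pos_of_ne_zero hv) hρ
end

section
/- Let G be a simple graph (not necessarily connected) on a nonempty finite vertex set V and let ρ : V → ℝ. There exists a real number b such that diag(ρ) + b·L(G) is positive definite if and only if for every connected component C of G one has ∑_{i∈C} ρ_i > 0, where L(G) is the graph Laplacian of G. -/
open Matrix in
/-- **Finsler's lemma**, one direction: if `A` is positive on the nonzero isotropic vectors of a
positive semidefinite matrix `B`, then `A + b • B` is positive definite for some real `b`. -/
theorem Matrix.PosSemidef.exists_posDef_add_smul {n : Type*} [Fintype n] {A B : Matrix n n ℝ}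
    (hB : B.PosSemidef) (hA : A.IsHermitian)
    (h : ∀ x : n → ℝ, x ≠ 0 → x ⬝ᵥ (B *ᵥ x) = 0 → 0 < x ⬝ᵥ (A *ᵥ x)) :
    ∃ b : ℝ, (A + b • B).PosDef := by
  have hcont (M : Matrix n n ℝ) : Continuous fun x : n → ℝ => x ⬝ᵥ (M *ᵥ x) := by fun_prop
  have hBnonneg (x : n → ℝ) : 0 ≤ x ⬝ᵥ (B *ᵥ x) := by
    simpa using hB.dotProduct_mulVec_nonneg x
  set K : Set (n → ℝ) := Metric.sphere 0 1 ∩ {x | x ⬝ᵥ (A *ᵥ x) ≤ 0}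
  have hKcompact : IsCompact K :=
    (isCompact_sphere 0 1).inter_right (isClosed_le (hcont A) continuous_const)
  have hBpos : ∀ x ∈ K, 0 < x ⬝ᵥ (B *ᵥ x) := by
    rintro x ⟨hx, hxA⟩
    refine (hBnonneg x).lt_of_ne' fun h0 => (h x ?_ h0).not_ge hxA
    exact ne_zero_of_mem_unit_sphere ⟨x, hx⟩
  obtain ⟨C, hC⟩ := hKcompact.bddAbove_image
    (f := fun x => -(x ⬝ᵥ (A *ᵥ x)) / (x ⬝ᵥ (B *ᵥ x)))
    ((hcont A).neg.continuousOn.div (hcont B).continuousOn fun x hx => (hBpos x hx).ne')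
  set b := max C 0 + 1
  have hb0 : 0 ≤ b := by positivity
  have hsphere : ∀ x ∈ Metric.sphere (0 : n → ℝ) 1,
      0 < x ⬝ᵥ (A *ᵥ x) + b * (x ⬝ᵥ (B *ᵥ x)) := by
    intro x hx
    rcases lt_or_ge 0 (x ⬝ᵥ (A *ᵥ x)) with hxA | hxA
    · exact add_pos_of_pos_of_nonneg hxA (mul_nonneg hb0 (hBnonneg x))
    · have hxB := hBpos x ⟨hx, hxA⟩
      have hle : -(x ⬝ᵥ (A *ᵥ x)) / (x ⬝ᵥ (B *ᵥ x)) ≤ C :=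
        hC (Set.mem_image_of_mem _ ⟨hx, hxA⟩)
      have hlt : -(x ⬝ᵥ (A *ᵥ x)) / (x ⬝ᵥ (B *ᵥ x)) < b := by
        linarith [le_max_left C 0]
      rw [div_lt_iff₀ hxB] at hlt
      linarith
  refine ⟨b, .of_dotProduct_mulVec_pos (hA.add (hB.smul hb0).isHermitian) fun x hx => ?_⟩
  have hpos := hsphere (‖x‖⁻¹ • x) (by simp [norm_smul, hx])
  simp only [mulVec_smul, smul_dotProduct, dotProduct_smul, smul_eq_mul] at hpos
  have hinv : 0 < ‖x‖⁻¹ := by positivity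
  simp only [star_trivial, add_mulVec, smul_mulVec, dotProduct_add, dotProduct_smul, smul_eq_mul]
  refine pos_of_mul_pos_right (a := ‖x‖⁻¹ * ‖x‖⁻¹) ?_ (by positivity)
  linarith

open Matrix in
theorem Matrix.dotProduct_diagonal_mulVec_self {n : Type*} [Fintype n] [DecidableEq n]
    (ρ x : n → ℝ) : x ⬝ᵥ (diagonal ρ *ᵥ x) = ∑ i, ρ i * x i ^ 2 := by
  simp only [dotProduct, mulVec_diagonal]
  exact Finset.sum_congr rfl fun i _ => by ring


/-- For a (not necessarily connected) simple graph `G` on a nonempty finite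
vertex set `V` and `ρ : V → ℝ`, there exists `b : ℝ` with `diag(ρ) + b • L(G)` positive
definite if and only if on every connected component the sum of the `ρ_i` is positive. -/
theorem exists_gain_posDef_iff_sum_pos_on_components
    {V : Type*} [Fintype V] [DecidableEq V] [Nonempty V]
    (G : SimpleGraph V) [DecidableRel G.Adj]
    [DecidableEq G.ConnectedComponent]
    (ρ : V → ℝ) :
    (∃ b : ℝ, (Matrix.diagonal ρ + b • G.lapMatrix ℝ).PosDef) ↔
      ∀ c : G.ConnectedComponent,
        0 < ∑ i ∈ Finset.univ.filter (fun i => G.connectedComponentMk i = c), ρ i := by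
  constructor
  · rintro ⟨b, hb⟩ c
    set x : V → ℝ := fun i => if G.connectedComponentMk i = c then 1 else 0 with hx
    have hLx : (G.lapMatrix ℝ).mulVec x = 0 :=
      SimpleGraph.mem_ker_toLin'_lapMatrix_of_connectedComponent c
    have hx0 : x ≠ 0 := by
      obtain ⟨i, rfl⟩ : ∃ i, G.connectedComponentMk i = c := c.exists_rep
      exact fun h0 => by simpa [hx] using congrFun h0 i
    have hpos := hb.dotProduct_mulVec_pos hx0
    rw [star_trivial, Matrix.add_mulVec, Matrix.smul_mulVec, hLx, smul_zero, add_zero,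
      Matrix.dotProduct_diagonal_mulVec_self] at hpos
    simpa [hx, Finset.sum_filter] using hpos
  · intro h
    refine (SimpleGraph.posSemidef_lapMatrix ℝ G).exists_posDef_add_smul
      (Matrix.isHermitian_diagonal ρ) fun x hx hLx => ?_
    rw [← Matrix.toLinearMap₂'_apply',
      SimpleGraph.lapMatrix_toLinearMap₂'_apply'_eq_zero_iff_forall_reachable] at hLx
    obtain ⟨y, rfl⟩ : ∃ y : G.ConnectedComponent → ℝ, x = fun i => y (G.connectedComponentMk i) :=
      ⟨Quot.lift x hLx, rfl⟩
    have hsum : ∑ i, ρ i * y (G.connectedComponentMk i) ^ 2 =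
        ∑ c, (∑ i with G.connectedComponentMk i = c, ρ i) * y c ^ 2 := by
      rw [← Finset.sum_fiberwise _ G.connectedComponentMk]
      refine Finset.sum_congr rfl fun c _ => ?_
      rw [Finset.sum_mul]
      exact Finset.sum_congr rfl fun i hi => by rw [(Finset.mem_filter.mp hi).2]
    rw [Matrix.dotProduct_diagonal_mulVec_self, hsum]
    obtain ⟨i, hi⟩ := Function.ne_iff.mp hx
    exact Finset.sum_pos' (fun c _ => mul_nonneg (h c).le (sq_nonneg _))
      ⟨G.connectedComponentMk i, Finset.mem_univ _, mul_pos (h _) (sq_pos_of_ne_zero hi)⟩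
end

section
/- For every real number β, the 2×2 matrix [[1+β, −β], [−β, β−1]] is not positive semidefinite. -/
/-- For every real `β`, the matrix `[[1+β, −β], [−β, β−1]]` is not positive
semidefinite. -/
theorem counterexample_not_posSemidef (β : ℝ) :
    ¬ (Matrix.PosSemidef !![1 + β, -β; -β, β - 1]) := by
  intro h
  have hdet := h.det_nonneg
  rw [Matrix.det_fin_two_of] at hdet
  linarith
end

section
/- Let V be a finite index set, ρ : V → ℝ, and for each i ∈ V let g_i : ℝ → ℝ satisfy (g_i(a) − g_i(b))·(a − b) ≥ ρ_i·(a − b)² for all real a, b. Let M be a real symmetric V×V matrix such that diag(ρ) + M is positive definite. Then the map F : (V → ℝ) → (V → ℝ) defined by F(y)_i = g_i(y_i) + (M y)_i is strictly monotone, i.e., (F(a) − F(b)) ⬝ (a − b) > 0 for all vectors a ≠ b. -/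
open scoped Matrix

/-- If each `g i` is `ρ i`-monotone and `diag(ρ) + M` is positive definite
(`M` symmetric), then `y ↦ (fun i => g i (y i)) + M y` is a strictly monotone map. -/
theorem regularized_relation_strictly_monotone
    {V : Type*} [Fintype V] [DecidableEq V]
    (ρ : V → ℝ) (g : V → ℝ → ℝ)
    (hg : ∀ i, ∀ a b : ℝ, ρ i * (a - b) ^ 2 ≤ (g i a - g i b) * (a - b))
    (M : Matrix V V ℝ) (hMsymm : M.IsSymm)
    (hPD : (Matrix.diagonal ρ + M).PosDef) :
    ∀ a b : V → ℝ, a ≠ b →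
      0 < (fun i => (g i (a i) + M.mulVec a i) - (g i (b i) + M.mulVec b i)) ⬝ᵥ (a - b) := by
  intro a b hab
  refine (hPD.dotProduct_mulVec_pos (sub_ne_zero.mpr hab)).trans_le ?_
  refine Finset.sum_le_sum fun i _ => ?_
  simp only [star_trivial, Matrix.add_mulVec, Matrix.mulVec_sub, Matrix.mulVec_diagonal,
    Pi.add_apply, Pi.sub_apply]
  linarith [hg i (a i) (b i)]
end

section
/- Let V be a finite index set, ρ : V → ℝ, and for each i ∈ V let f_i : ℝ → ℝ be a function such that x ↦ f_i(x) − (ρ_i/2)·x² is convex on ℝ. Let M be a real symmetric V×V matrix such that diag(ρ) + M is positive semidefinite. Then the function Φ : (V → ℝ) → ℝ given by Φ(y) = ∑_{i∈V} f_i(y_i) + (1/2)·yᵀ M y is convex on ℝ^V. -/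
open scoped Matrix

/-- The quadratic form of a positive semidefinite real matrix is convex. -/
theorem Matrix.PosSemidef.convexOn_dotProduct_mulVec {V : Type*} [Fintype V]
    {A : Matrix V V ℝ} (hA : A.PosSemidef) :
    ConvexOn ℝ Set.univ (fun y : V → ℝ => y ⬝ᵥ A *ᵥ y) := by
  refine ⟨convex_univ, fun x _ y _ a b ha hb hab => ?_⟩
  have h : 0 ≤ (x - y) ⬝ᵥ A *ᵥ (x - y) := by
    simpa using hA.dotProduct_mulVec_nonneg (x - y)
  have h' := mul_nonneg (mul_nonneg ha hb) h
  obtain rfl : b = 1 - a := by linarith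
  simp only [Matrix.mulVec_add, Matrix.mulVec_sub, Matrix.mulVec_smul, add_dotProduct,
    dotProduct_add, sub_dotProduct, dotProduct_sub, smul_dotProduct, dotProduct_smul,
    smul_eq_mul] at h' ⊢
  linarith

/-- A finite sum of convex functions of the separate coordinates is convex. -/
theorem convexOn_sum_apply {V : Type*} [Fintype V] {g : V → ℝ → ℝ}
    (hg : ∀ i, ConvexOn ℝ Set.univ (g i)) :
    ConvexOn ℝ Set.univ (fun y : V → ℝ => ∑ i, g i (y i)) := by
  refine ⟨convex_univ, fun x _ y _ a b ha hb hab => ?_⟩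
  simp only [Finset.smul_sum, ← Finset.sum_add_distrib]
  exact Finset.sum_le_sum fun i _ => (hg i).2 trivial trivial ha hb hab

/-- If each `f i` satisfies that `x ↦ f i x − (ρ i / 2) x²` is convex and
`diag(ρ) + M` is positive semidefinite (`M` symmetric), then
`y ↦ ∑ i, f i (y i) + (1/2) yᵀ M y` is convex on `ℝ^V`. -/
theorem regularized_potential_convex
    {V : Type*} [Fintype V] [DecidableEq V]
    (ρ : V → ℝ) (f : V → ℝ → ℝ)
    (hf : ∀ i, ConvexOn ℝ Set.univ (fun x : ℝ => f i x - (ρ i / 2) * x ^ 2))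
    (M : Matrix V V ℝ) (hMsymm : M.IsSymm)
    (hPSD : (Matrix.diagonal ρ + M).PosSemidef) :
    ConvexOn ℝ Set.univ
      (fun y : V → ℝ => (∑ i, f i (y i)) + (1 / 2) * (y ⬝ᵥ M.mulVec y)) := by
  refine ((convexOn_sum_apply hf).add (hPSD.convexOn_dotProduct_mulVec.smul
    (by norm_num : (0 : ℝ) ≤ 1 / 2))).congr fun y _ => ?_
  have h : y ⬝ᵥ Matrix.diagonal ρ *ᵥ y = 2 * ∑ i, ρ i / 2 * y i ^ 2 := by
    simp only [dotProduct, Matrix.mulVec_diagonal, Finset.mul_sum]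
    exact Finset.sum_congr rfl fun i _ => by ring
  simp only [Pi.add_apply, smul_eq_mul, Finset.sum_sub_distrib, Matrix.add_mulVec,
    dotProduct_add, h]
  ring
end
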